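/- For h = 0, the AT condition β² E[1/cosh⁴(β√q Z)] ≤ 1 (where q is the largest fixed point of φ(x) = E[tanh²(β√x Z)]) holds if and only if |β| ≤ 1. -/

import Mathlib

open MeasureTheory ProbabilityTheory

/-- `φ(x) = E[tanh²(h + β √x Z)]`, `Z` a standard Gaussian. Here `h = 0`. -/
noncomputable def phi (h β x : ℝ) : ℝ :=
  ∫ z, Real.tanh (h + β * Real.sqrt x * z) ^ 2 ∂(gaussianReal 0 1)

lemma aux_tanh_deriv (y : ℝ) : HasDerivAt Real.tanh (1 / Real.cosh y ^ 2) y := by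
  have h : Real.tanh = fun x => Real.sinh x / Real.cosh x := by
    funext x; exact Real.tanh_eq_sinh_div_cosh x
  rw [h]
  have hc := (Real.cosh_pos y).ne'
  refine ((Real.hasDerivAt_sinh y).fun_div (Real.hasDerivAt_cosh y) hc).congr_deriv ?_
  rw [show Real.cosh y * Real.cosh y - Real.sinh y * Real.sinh y = 1 by
    nlinarith [Real.cosh_sq y]]

lemma aux_sech_le (y : ℝ) : 1 / Real.cosh y ^ 2 ≤ 1 := by
  rw [div_le_one (by have := Real.cosh_pos y; positivity)]
  nlinarith [Real.one_le_cosh y]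

lemma aux_sech_nonneg (y : ℝ) : 0 ≤ 1 / Real.cosh y ^ 2 := by positivity

lemma aux_tanh_le (y : ℝ) : |Real.tanh y| ≤ |y| := by
  have := Convex.norm_image_sub_le_of_norm_hasDerivWithin_le (f := Real.tanh)
    (f' := fun y => 1 / Real.cosh y ^ 2) (C := 1) (s := Set.univ) (x := 0) (y := y)
    (fun x _ => (aux_tanh_deriv x).hasDerivWithinAt)
    (fun x _ => by rw [Real.norm_eq_abs, abs_of_nonneg (aux_sech_nonneg x)]; exact aux_sech_le x)
    convex_univ trivial trivial
  simpa using this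

lemma aux_tanh_le_one (y : ℝ) : |Real.tanh y| ≤ 1 := by
  have hc := Real.cosh_pos y
  rw [Real.tanh_eq_sinh_div_cosh, abs_div, abs_of_pos hc, div_le_one hc]
  apply abs_le_of_sq_le_sq _ hc.le
  nlinarith [Real.cosh_sq y]

lemma aux_cont_tanh : Continuous Real.tanh :=
  continuous_iff_continuousAt.2 fun y => (aux_tanh_deriv y).continuousAt

lemma aux_meas_tanh : Measurable Real.tanh := aux_cont_tanh.measurable

/-- `g(z)/z` is bounded by `|s|`. -/
lemma aux_quot (s z : ℝ) : |Real.tanh (s * z) / z| ≤ |s| := by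
  by_cases hz : z = 0
  · simp [hz]
  · rw [abs_div, div_le_iff₀ (abs_pos.2 hz), ← abs_mul]; exact aux_tanh_le _

lemma aux_gd (s z : ℝ) : HasDerivAt (fun z => Real.tanh (s * z))
    (s * (1 / Real.cosh (s * z) ^ 2)) z := by
  have := (aux_tanh_deriv (s * z)).comp z ((hasDerivAt_id z).const_mul s)
  refine this.congr_deriv ?_
  ring

/-- derivative of `tanh(sz)^2/z` -/
lemma aux_hd (s z : ℝ) : HasDerivAt (fun z => Real.tanh (s * z) ^ 2 / z)
    (if z = 0 then s ^ 2 else 2 * (Real.tanh (s * z) / z) * (s * (1 / Real.cosh (s * z) ^ 2))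
      - (Real.tanh (s * z) / z) ^ 2) z := by
  split_ifs with hz
  · subst hz
    have h := aux_gd s 0
    rw [hasDerivAt_iff_tendsto_slope] at h ⊢
    have h2 := h.pow 2
    simp only [mul_zero, Real.cosh_zero, one_pow, div_one, mul_one] at h2
    refine h2.congr' ?_
    filter_upwards [self_mem_nhdsWithin] with x hx
    have hx : x ≠ 0 := hx
    simp [slope_def_field]
    field_simp
  · refine (((aux_gd s z).fun_pow 2).fun_div (hasDerivAt_id' z) hz).congr_deriv ?_
    simp
    field_simp

lemma aux_rho (z : ℝ) : HasDerivAt (gaussianPDFReal 0 1) (- z * gaussianPDFReal 0 1 z) z := by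
  rw [gaussianPDFReal_def]
  have h : HasDerivAt (fun x : ℝ => -(x - 0) ^ 2 / (2 * ((1 : NNReal) : ℝ))) (-z) z := by
    have := ((((hasDerivAt_id z).sub_const 0).fun_pow 2).fun_neg).div_const (2 * ((1 : NNReal) : ℝ))
    refine this.congr_deriv ?_
    simp
    ring
  refine ((h.exp).const_mul ((√(2 * Real.pi * ((1 : NNReal) : ℝ)))⁻¹)).congr_deriv ?_
  ring

lemma aux_int_rho (f : ℝ → ℝ) (hf : Measurable f) (C : ℝ) (hC : ∀ z, |f z| ≤ C) :
    Integrable (fun z => gaussianPDFReal 0 1 z * f z) := by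
  refine (integrable_gaussianPDFReal 0 1).mul_bdd (c := C) hf.aestronglyMeasurable
    (ae_of_all _ fun z => ?_)
  simpa using hC z

lemma aux_int_g (f : ℝ → ℝ) (hf : Measurable f) (C : ℝ) (hC : ∀ z, |f z| ≤ C) :
    Integrable f (gaussianReal 0 1) :=
  Integrable.of_bound hf.aestronglyMeasurable C (ae_of_all _ fun z => by simpa using hC z)

lemma aux_ae_ne : ∀ᵐ z : ℝ, z ≠ 0 := by
  simp [ae_iff]

lemma aux_bd (s z : ℝ) : |2 * (Real.tanh (s * z) / z) * (s * (1 / Real.cosh (s * z) ^ 2))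
      - (Real.tanh (s * z) / z) ^ 2 - Real.tanh (s * z) ^ 2| ≤ 3 * s ^ 2 + 1 := by
  have h1 := aux_quot s z
  have h2 : |s * (1 / Real.cosh (s * z) ^ 2)| ≤ |s| := by
    rw [abs_mul, abs_of_nonneg (aux_sech_nonneg _)]
    exact mul_le_of_le_one_right (abs_nonneg _) (aux_sech_le _)
  have h3 := aux_tanh_le_one (s * z)
  generalize Real.tanh (s * z) / z = a at *
  generalize s * (1 / Real.cosh (s * z) ^ 2) = b at *
  generalize Real.tanh (s * z) = t at *
  have h1 := sq_le_sq.2 h1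
  have h2 := sq_le_sq.2 h2
  have h3 : t ^ 2 ≤ 1 := by rw [← one_pow 2]; exact sq_le_sq.2 (by simpa using h3)
  rw [abs_le]
  constructor <;> nlinarith [sq_nonneg (a - b), sq_nonneg (a + b), sq_nonneg t, sq_nonneg a]

lemma aux_meas (s : ℝ) : Measurable fun z : ℝ =>
    2 * (Real.tanh (s * z) / z) * (s * (1 / Real.cosh (s * z) ^ 2))
      - (Real.tanh (s * z) / z) ^ 2 - Real.tanh (s * z) ^ 2 := by
  have h1 : Measurable fun z : ℝ => Real.tanh (s * z) := aux_meas_tanh.comp (by fun_prop)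
  have h2 : Measurable fun z : ℝ => Real.cosh (s * z) :=
    Real.continuous_cosh.measurable.comp (by fun_prop)
  fun_prop

lemma aux_stein (s : ℝ) :
    ∫ z, (2 * (Real.tanh (s * z) / z) * (s * (1 / Real.cosh (s * z) ^ 2))
      - (Real.tanh (s * z) / z) ^ 2 - Real.tanh (s * z) ^ 2) ∂(gaussianReal 0 1) = 0 := by
  rw [integral_gaussianReal_eq_integral_smul (by norm_num)]
  simp only [smul_eq_mul]
  have hI := aux_int_rho _ (aux_meas s) _ (aux_bd s)
  have hae : (fun z => gaussianPDFReal 0 1 z * (2 * (Real.tanh (s * z) / z)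
      * (s * (1 / Real.cosh (s * z) ^ 2))
      - (Real.tanh (s * z) / z) ^ 2 - Real.tanh (s * z) ^ 2)) =ᵐ[volume]
      fun z => (- z * gaussianPDFReal 0 1 z) * (Real.tanh (s * z) ^ 2 / z) +
        gaussianPDFReal 0 1 z * (if z = 0 then s ^ 2 else
        2 * (Real.tanh (s * z) / z) * (s * (1 / Real.cosh (s * z) ^ 2))
      - (Real.tanh (s * z) / z) ^ 2) := by
    filter_upwards [aux_ae_ne] with z hz
    rw [if_neg hz]
    have : z * (Real.tanh (s * z) ^ 2 / z) = Real.tanh (s * z) ^ 2 := by field_simp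
    linear_combination (-gaussianPDFReal 0 1 z) * (-this)
  rw [integral_congr_ae hae]
  refine integral_eq_zero_of_hasDerivAt_of_integrable
    (f := fun z => gaussianPDFReal 0 1 z * (Real.tanh (s * z) ^ 2 / z))
    (fun z => (aux_rho z).fun_mul (aux_hd s z)) (hI.congr hae) ?_
  have h1 : Measurable fun z : ℝ => Real.tanh (s * z) := aux_meas_tanh.comp (by fun_prop)
  refine aux_int_rho _ (by fun_prop) |s| fun z => ?_
  rw [pow_two, mul_div_assoc, abs_mul]
  have := aux_tanh_le_one (s * z)
  have := aux_quot s z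
  exact (mul_le_of_le_one_left (abs_nonneg _) (aux_tanh_le_one _)).trans this

lemma aux_ne (y : ℝ) (hy : y ≠ 0) : Real.tanh y * Real.cosh y ^ 2 ≠ y := by
  intro h
  rw [Real.tanh_eq_sinh_div_cosh] at h
  have hc := (Real.cosh_pos y).ne'
  have h2 : Real.sinh (2 * y) = 2 * y := by
    rw [Real.sinh_two_mul]; field_simp at h; linarith
  have h3 := Real.self_le_sinh_iff.1 h2.ge
  have h4 := Real.sinh_le_self_iff.1 h2.le
  exact hy (by linarith)

/-- Strict Gaussian Poincaré inequality for `z ↦ tanh (s z)`. -/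
lemma aux_poincare (s : ℝ) (hs : s ≠ 0) :
    ∫ z, Real.tanh (s * z) ^ 2 ∂(gaussianReal 0 1) <
      s ^ 2 * ∫ z, 1 / Real.cosh (s * z) ^ 4 ∂(gaussianReal 0 1) := by
  have h1 : Measurable fun z : ℝ => Real.tanh (s * z) := aux_meas_tanh.comp (by fun_prop)
  have h2 : Measurable fun z : ℝ => Real.cosh (s * z) :=
    Real.continuous_cosh.measurable.comp (by fun_prop)
  have iT : Integrable (fun z => Real.tanh (s * z) ^ 2) (gaussianReal 0 1) := by
    refine aux_int_g _ (by fun_prop) 1 fun z => ?_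
    rw [abs_pow]; exact pow_le_one₀ (abs_nonneg _) (aux_tanh_le_one _)
  have iC : Integrable (fun z => 1 / Real.cosh (s * z) ^ 4) (gaussianReal 0 1) := by
    refine aux_int_g _ (by fun_prop) 1 fun z => ?_
    rw [abs_of_nonneg (by positivity), div_le_one (by have := Real.cosh_pos (s * z); positivity)]
    exact one_le_pow₀ (Real.one_le_cosh _)
  have iS := aux_int_g _ (aux_meas s) _ (aux_bd s)
  have key : ∀ z, (s * (1 / Real.cosh (s * z) ^ 2) - Real.tanh (s * z) / z) ^ 2 =
      s ^ 2 * (1 / Real.cosh (s * z) ^ 4) - Real.tanh (s * z) ^ 2 -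
      (2 * (Real.tanh (s * z) / z) * (s * (1 / Real.cosh (s * z) ^ 2))
      - (Real.tanh (s * z) / z) ^ 2 - Real.tanh (s * z) ^ 2) := by
    intro z
    ring
  have iK : Integrable (fun z => (s * (1 / Real.cosh (s * z) ^ 2) - Real.tanh (s * z) / z) ^ 2)
      (gaussianReal 0 1) := by
    simp_rw [key]
    exact ((iC.const_mul _).sub iT).sub iS
  have e : ∫ z, (s * (1 / Real.cosh (s * z) ^ 2) - Real.tanh (s * z) / z) ^ 2
      ∂(gaussianReal 0 1) = s ^ 2 * ∫ z, 1 / Real.cosh (s * z) ^ 4 ∂(gaussianReal 0 1)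
      - ∫ z, Real.tanh (s * z) ^ 2 ∂(gaussianReal 0 1) := by
    simp_rw [key]
    have iCT : Integrable (fun z => s ^ 2 * (1 / Real.cosh (s * z) ^ 4) - Real.tanh (s * z) ^ 2)
        (gaussianReal 0 1) := (iC.const_mul _).sub iT
    rw [integral_sub iCT iS, aux_stein, integral_sub (iC.const_mul _) iT,
      integral_const_mul, sub_zero]
  rw [← sub_pos, ← e]
  have hnn := integral_nonneg (μ := gaussianReal 0 1)
    (f := fun z => (s * (1 / Real.cosh (s * z) ^ 2) - Real.tanh (s * z) / z) ^ 2)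
    (fun z => sq_nonneg _)
  refine lt_of_le_of_ne hnn fun h0 => ?_
  have hz := (integral_eq_zero_iff_of_nonneg (fun z => sq_nonneg _) iK).1 h0.symm
  have hn := (gaussianReal_absolutelyContinuous 0 (v := 1) (by norm_num)).ae_le aux_ae_ne
  obtain ⟨z, ha, hb⟩ := (hz.and hn).exists
  have ha : (s * (1 / Real.cosh (s * z) ^ 2) - Real.tanh (s * z) / z) ^ 2 = 0 := ha
  have ha := pow_eq_zero_iff (two_ne_zero) |>.1 ha
  have hc := (Real.cosh_pos (s * z)).ne'
  apply aux_ne (s * z) (mul_ne_zero hs hb)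
  field_simp at ha
  linarith

/-- For `h = 0` and `q` the largest fixed point of `φ`, the AT condition
`β² E[cosh⁻⁴(β √q Z)] ≤ 1` holds if and only if `|β| ≤ 1`. -/
theorem stmt16 (β q : ℝ) (hq0 : 0 ≤ q) (hfix : phi 0 β q = q)
    (hmax : ∀ x, 0 ≤ x → phi 0 β x = x → x ≤ q) :
    (β ^ 2 * ∫ z, 1 / Real.cosh (β * Real.sqrt q * z) ^ 4 ∂(gaussianReal 0 1)) ≤ 1 ↔
      |β| ≤ 1 := by
  constructor
  · intro h
    by_contra hb
    rw [not_le] at hb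
    have hb2 : 1 < β ^ 2 := by rw [← sq_abs]; nlinarith
    rcases hq0.eq_or_lt with rfl | hq
    · simp at h
      have : β ^ 2 ≤ 1 := by simpa using h
      linarith
    · have hs : β * Real.sqrt q ≠ 0 :=
        mul_ne_zero (by rintro rfl; norm_num at hb2) (Real.sqrt_pos.2 hq).ne'
      have hp := aux_poincare _ hs
      unfold phi at hfix
      simp only [zero_add] at hfix
      rw [hfix, mul_pow, Real.sq_sqrt hq0] at hp
      nlinarith
  · intro hb
    have hb2 : β ^ 2 ≤ 1 := by rw [← sq_abs]; exact pow_le_one₀ (abs_nonneg _) hb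
    have hI : ∫ z, 1 / Real.cosh (β * Real.sqrt q * z) ^ 4 ∂(gaussianReal 0 1) ≤ 1 := by
      have := integral_mono_of_nonneg (μ := gaussianReal 0 1)
        (f := fun z => 1 / Real.cosh (β * Real.sqrt q * z) ^ 4) (g := fun _ => (1 : ℝ))
        (ae_of_all _ fun z => by positivity) (integrable_const _)
        (ae_of_all _ fun z => by
          have := Real.cosh_pos (β * Real.sqrt q * z)
          show 1 / Real.cosh (β * Real.sqrt q * z) ^ 4 ≤ 1
          rw [div_le_one (by positivity)]
          exact one_le_pow₀ (Real.one_le_cosh _))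
      simpa using this
    have hI0 : 0 ≤ ∫ z, 1 / Real.cosh (β * Real.sqrt q * z) ^ 4 ∂(gaussianReal 0 1) :=
      integral_nonneg fun z => by positivity
    nlinarith
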